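/- Let α be an admissible exponent of A. The sequence A is α-uniform exponentially bounded (i.e., there is a constant M > 0 with ‖A(m,n)‖ ≤ M e^{α(m−n)} for all m ≥ n) if and only if c00(α) = c00 (equality as sets of sequences). -/

import Mathlib

open Filter Topology

variable {E : Type*} [NormedAddCommGroup E] [NormedSpace ℝ E] [CompleteSpace E]

/-- `evol A n m` is the evolution operator `A(m,n) = A_{m-1} ∘ ⋯ ∘ A_n`
(the identity if `m ≤ n`). -/
def evol (A : ℕ → E →L[ℝ] E) (n : ℕ) : ℕ → E →L[ℝ] E
  | 0 => 1
  | m + 1 => if n ≤ m then A m * evol A n m else 1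

/-- `α` is an admissible exponent for `A`: there is a positive sequence `M` with
`‖A(m,n)‖ ≤ M n * e^{α (m - n)}` for all `m ≥ n`. -/
def IsAdmissible (A : ℕ → E →L[ℝ] E) (α : ℝ) : Prop :=
  ∃ M : ℕ → ℝ, (∀ n, 0 < M n) ∧
    ∀ m n : ℕ, n ≤ m → ‖evol A n m‖ ≤ M n * Real.exp (α * ((m : ℝ) - (n : ℝ)))

/-- The norm `‖x‖_{n,α} = sup_{m ≥ n} e^{-α(m-n)} ‖A(m,n) x‖`. -/
noncomputable def nnorm (A : ℕ → E →L[ℝ] E) (α : ℝ) (n : ℕ) (x : E) : ℝ :=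
  ⨆ m : Set.Ici n, Real.exp (-α * (((m : ℕ) : ℝ) - (n : ℝ))) * ‖evol A n (m : ℕ) x‖

/-- Membership in `c00(α)`: `u 0 = 0` and `‖u n‖_{n,α} → 0`. -/
def MemC00 (A : ℕ → E →L[ℝ] E) (α : ℝ) (u : ℕ → E) : Prop :=
  u 0 = 0 ∧ Tendsto (fun n => nnorm A α n (u n)) atTop (𝓝 0)

/-- The norm `‖u‖_α = sup_n ‖u n‖_{n,α}` on `c00(α)`. -/
noncomputable def cnorm (A : ℕ → E →L[ℝ] E) (α : ℝ) (u : ℕ → E) : ℝ :=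
  ⨆ n, nnorm A α n (u n)

/-- The evolution map `T`: `(Tu)_0 = 0`, `(Tu)_{n+1} = A_n u_n`. -/
def Tmap (A : ℕ → E →L[ℝ] E) (u : ℕ → E) : ℕ → E
  | 0 => 0
  | m + 1 => A m (u m)

/-- `G = T - Id`. -/
def Gmap (A : ℕ → E →L[ℝ] E) (u : ℕ → E) : ℕ → E :=
  fun n => Tmap A u n - u n

/-- Membership in `c00` (with the original norm of `E`). -/
def MemC00u (u : ℕ → E) : Prop :=
  u 0 = 0 ∧ Tendsto (fun n => ‖u n‖) atTop (𝓝 0)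

section Helpers

variable {F : Type*} [NormedAddCommGroup F] [NormedSpace ℝ F]
  {A : ℕ → F →L[ℝ] F} {α : ℝ}

lemma evol_self (A : ℕ → F →L[ℝ] F) (n : ℕ) : evol A n n = 1 := by
  cases n <;> simp [evol]

lemma exp_neg_mul_norm_evol_le {C : ℝ} {n m : ℕ}
    (h : ‖evol A n m‖ ≤ C * Real.exp (α * ((m : ℝ) - n))) (x : F) :
    Real.exp (-α * ((m : ℝ) - n)) * ‖evol A n m x‖ ≤ C * ‖x‖ := by
  have hx := (evol A n m).le_of_opNorm_le h x
  calc Real.exp (-α * ((m : ℝ) - n)) * ‖evol A n m x‖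
      ≤ Real.exp (-α * ((m : ℝ) - n)) * (C * Real.exp (α * ((m : ℝ) - n)) * ‖x‖) := by gcongr
    _ = Real.exp (-α * ((m : ℝ) - n) + α * ((m : ℝ) - n)) * (C * ‖x‖) := by
        rw [Real.exp_add]; ring
    _ = C * ‖x‖ := by simp

lemma nnorm_le {C : ℝ} {n : ℕ}
    (h : ∀ m, n ≤ m → ‖evol A n m‖ ≤ C * Real.exp (α * ((m : ℝ) - n))) (x : F) :
    nnorm A α n x ≤ C * ‖x‖ := by
  have : Nonempty (Set.Ici n) := Set.nonempty_Ici.to_subtype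
  exact ciSup_le fun m => exp_neg_mul_norm_evol_le (h m m.2) x

lemma IsAdmissible.le_nnorm (hα : IsAdmissible A α) {n m : ℕ} (hm : n ≤ m) (x : F) :
    Real.exp (-α * ((m : ℝ) - n)) * ‖evol A n m x‖ ≤ nnorm A α n x := by
  obtain ⟨M, -, hM⟩ := hα
  have hb : BddAbove (Set.range fun m : Set.Ici n =>
      Real.exp (-α * (((m : ℕ) : ℝ) - (n : ℝ))) * ‖evol A n (m : ℕ) x‖) := by
    refine ⟨M n * ‖x‖, ?_⟩
    rintro _ ⟨m, rfl⟩
    exact exp_neg_mul_norm_evol_le (hM m n m.2) x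
  exact le_ciSup hb ⟨m, hm⟩

lemma IsAdmissible.norm_le_nnorm (hα : IsAdmissible A α) (n : ℕ) (x : F) :
    ‖x‖ ≤ nnorm A α n x := by
  simpa [evol_self] using hα.le_nnorm (le_refl n) x

/-- If `‖·‖_{n,α} < 1` on the ball of radius `1 / (k + 1)`, then `A(m,n)` is bounded by
`(k + 1) e^{α(m-n)}`. -/
lemma IsAdmissible.norm_evol_le (hα : IsAdmissible A α) {n k : ℕ}
    (h : ∀ x : F, ‖x‖ ≤ 1 / ((k : ℝ) + 1) → nnorm A α n x < 1) {m : ℕ} (hm : n ≤ m) :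
    ‖evol A n m‖ ≤ ((k : ℝ) + 1) * Real.exp (α * ((m : ℝ) - n)) := by
  have hk : (0 : ℝ) < (k : ℝ) + 1 := by positivity
  refine ContinuousLinearMap.opNorm_le_of_unit_norm (by positivity) fun x hx => ?_
  have hy : ‖(1 / ((k : ℝ) + 1)) • x‖ ≤ 1 / ((k : ℝ) + 1) := by
    rw [norm_smul, hx, mul_one, Real.norm_of_nonneg (by positivity)]
  have h1 := (hα.le_nnorm hm _).trans (h _ hy).le
  rw [map_smul, norm_smul, Real.norm_of_nonneg (by positivity), neg_mul, Real.exp_neg] at h1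
  have he := Real.exp_pos (α * ((m : ℝ) - n))
  field_simp at h1
  linarith

/-- Failure of a uniform bound yields, for each `k`, arbitrarily late vectors of norm at most
`1 / (k + 1)` whose `‖·‖_{n,α}` norm is at least `1`. -/
lemma IsAdmissible.frequently_one_le_nnorm (hα : IsAdmissible A α)
    (hA : ¬ ∃ M : ℝ, 0 < M ∧
      ∀ m n : ℕ, n ≤ m → ‖evol A n m‖ ≤ M * Real.exp (α * ((m : ℝ) - n))) (k : ℕ) :
    ∃ᶠ n in atTop, ∃ x : F, ‖x‖ ≤ 1 / ((k : ℝ) + 1) ∧ 1 ≤ nnorm A α n x := by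
  intro hev
  apply hA
  obtain ⟨N, hN⟩ := eventually_atTop.1 hev
  obtain ⟨M, hM0, hM⟩ := id hα
  have hS : 0 ≤ ∑ i ∈ Finset.range N, M i := Finset.sum_nonneg fun i _ => (hM0 i).le
  refine ⟨((k : ℝ) + 1) + ∑ i ∈ Finset.range N, M i, by positivity, fun m n hnm => ?_⟩
  rcases lt_or_ge n N with hn | hn
  · have hle : M n ≤ ∑ i ∈ Finset.range N, M i :=
      Finset.single_le_sum (fun i _ => (hM0 i).le) (Finset.mem_range.2 hn)
    refine (hM m n hnm).trans ?_
    gcongr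
    linarith [(k.cast_nonneg : (0 : ℝ) ≤ k)]
  · refine (hα.norm_evol_le (k := k) (fun x hx => ?_) hnm).trans ?_
    · by_contra! hcon
      exact hN n hn ⟨x, hx, hcon⟩
    · exact mul_le_mul_of_nonneg_right (by linarith) (Real.exp_pos _).le

end Helpers

/-- Extension by zero along a strictly monotone map preserves convergence to zero. -/
lemma StrictMono.tendsto_norm_extend_zero {G : Type*} [NormedAddCommGroup G] {φ : ℕ → ℕ}
    (hφ : StrictMono φ) {x : ℕ → G} (hx : Tendsto (fun k => ‖x k‖) atTop (𝓝 0)) :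
    Tendsto (fun n => ‖Function.extend φ x 0 n‖) atTop (𝓝 0) := by
  rw [Metric.tendsto_atTop] at hx ⊢
  intro ε hε
  obtain ⟨K, hK⟩ := hx ε hε
  refine ⟨φ K, fun n hn => ?_⟩
  by_cases hr : ∃ k, φ k = n
  · obtain ⟨k, rfl⟩ := hr
    rw [hφ.injective.extend_apply]
    exact hK k (hφ.le_iff_le.1 hn)
  · simpa [Function.extend_apply' _ _ _ hr] using hε

/-- `A` is `α`-uniform exponentially bounded iff `c00(α) = c00`. -/
theorem stmt13 (A : ℕ → E →L[ℝ] E) (α : ℝ) (hα : IsAdmissible A α) :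
    (∃ M : ℝ, 0 < M ∧
        ∀ m n : ℕ, n ≤ m → ‖evol A n m‖ ≤ M * Real.exp (α * ((m : ℝ) - (n : ℝ)))) ↔
      (∀ u : ℕ → E, MemC00 A α u ↔ MemC00u u) := by
  constructor
  · rintro ⟨M, -, hM⟩ u
    refine and_congr_right fun _ => ⟨fun h => ?_, fun h => ?_⟩
    · exact squeeze_zero (fun n => norm_nonneg _) (fun n => hα.norm_le_nnorm n (u n)) h
    · refine squeeze_zero (fun n => (norm_nonneg _).trans (hα.norm_le_nnorm n (u n)))
        (fun n => nnorm_le (fun m hm => hM m n hm) (u n)) ?_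
      simpa using h.const_mul M
  · intro hu
    by_contra hA
    obtain ⟨φ, hφ, hφx⟩ := extraction_forall_of_frequently fun k =>
      (hα.frequently_one_le_nnorm hA k).and_eventually (eventually_gt_atTop 0)
    choose hx hpos using hφx
    choose x hx1 hx2 using hx
    have hx0 : Tendsto (fun k => ‖x k‖) atTop (𝓝 0) :=
      squeeze_zero (fun k => norm_nonneg _) hx1 tendsto_one_div_add_atTop_nhds_zero_nat
    have hmem : MemC00u (Function.extend φ x 0) := by
      refine ⟨?_, hφ.tendsto_norm_extend_zero hx0⟩
      rw [Function.extend_apply' _ _ _ fun ⟨k, hk⟩ => (hpos k).ne' hk]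
      rfl
    have hlim := ((hu _).2 hmem).2.comp hφ.tendsto_atTop
    have hge : (1 : ℝ) ≤ 0 := ge_of_tendsto' hlim fun k => by
      simpa [hφ.injective.extend_apply] using hx2 k
    norm_num at hge
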